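/- Let k be a field, let F be a field extension of k, and let K be a finite separable field extension of F (with compatible k-algebra structures, so that k ⊆ F ⊆ K is a tower). Given a k-linear derivation d : F → F, there exists a unique k-linear derivation D : K → K extending d, i.e. satisfying D(ι(a)) = ι(d(a)) for all a ∈ F, where ι : F → K is the inclusion. -/

import Mathlib

/-- If `k ⊆ F ⊆ K` is a tower of fields with `K/F` finite and separable,
then every `k`-linear derivation `d` of `F` extends uniquely to a `k`-linear derivation `D`
of `K`. -/
theorem stmt7 (k F K : Type*) [Field k] [Field F] [Field K]
    [Algebra k F] [Algebra F K] [Algebra k K] [IsScalarTower k F K]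
    [FiniteDimensional F K] [Algebra.IsSeparable F K]
    (d : Derivation k F F) :
    ∃! D : Derivation k K K, ∀ a : F, D (algebraMap F K a) = algebraMap F K (d a) := by
  have : Algebra.FormallyEtale F K := Algebra.FormallyEtale.of_isSeparable F K
  let e := KaehlerDifferential.tensorKaehlerEquivOfFormallyEtale k F K
  have he : ∀ a : F, e (1 ⊗ₜ[F] KaehlerDifferential.D k F a)
      = KaehlerDifferential.D k K (algebraMap F K a) := by
    intro a
    rw [KaehlerDifferential.tensorKaehlerEquivOfFormallyEtale_apply,
      KaehlerDifferential.mapBaseChange_tmul, one_smul, KaehlerDifferential.map_D]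
  let g : Ω[F⁄k] →ₗ[F] K := (Algebra.linearMap F K) ∘ₗ d.liftKaehlerDifferential
  let f : Ω[K⁄k] →ₗ[K] K := (g.liftBaseChange K) ∘ₗ e.symm.toLinearMap
  refine ⟨f.compDer (KaehlerDifferential.D k K), ?_, ?_⟩
  · intro a
    have : e.symm (KaehlerDifferential.D k K (algebraMap F K a))
      = 1 ⊗ₜ[F] KaehlerDifferential.D k F a := by rw [← he, e.symm_apply_apply]
    simp [f, g, this]
  · intro D hD
    have h : D.liftKaehlerDifferential ∘ₗ e.toLinearMap = g.liftBaseChange K := by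
      ext : 2
      refine Derivation.liftKaehlerDifferential_unique (R := k) (S := F) (M := K) _ _ ?_
      ext a
      simp [he, g, hD]
    ext x
    have h2 := LinearMap.congr_fun h (e.symm (KaehlerDifferential.D k K x))
    simpa [f] using h2
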